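/- Let c = Σ_{j∈Θ} c_j δ_{z_j} be an atomic measure on X (Θ finite and nonempty, c_j > 0) and let P, Q ∈ X. Suppose there exists t₁ ∈ ℝ such that either π(P) ≥ t₁ ≥ max_{j∈Θ} π(z_j) or π(P) ≤ t₁ ≤ min_{j∈Θ} π(z_j). Then d_α(c, m(c)·δ_P) − d_α(c, m(c)·δ_Q) ≥ m(c)^α · ( |π(P) − t₁| − C·R − |π(Q) − t₁| ), where R = max{ ‖z − p − π(z)·v‖ : z ∈ {z_j : j ∈ Θ} ∪ {P, Q} }. -/

import Mathlib

open scoped BigOperators RealInnerProductSpace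

noncomputable section

attribute [local instance] Classical.propDecidable

/-- Points of the ambient Euclidean space `ℝ^m`. -/
abbrev Pt (m : ℕ) := EuclideanSpace ℝ (Fin m)

/-- A weighted directed graph in `ℝ^m`: a finite vertex set, a finite set of
directed edges (ordered pairs of points, viewed as directed line segments), and
a weight function. -/
structure WDG (m : ℕ) where
  V : Finset (Pt m)
  E : Finset (Pt m × Pt m)
  w : Pt m × Pt m → ℝ

namespace WDG

variable {m : ℕ}

/-- Edges join distinct vertices of the graph and carry positive weight. -/
def edgesOK (G : WDG m) : Prop :=
  ∀ e ∈ G.E, e.1 ∈ G.V ∧ e.2 ∈ G.V ∧ e.1 ≠ e.2 ∧ 0 < G.w e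

/-- The underlying undirected (simple) graph. -/
def undirected (G : WDG m) : SimpleGraph (Pt m) :=
  SimpleGraph.fromRel (fun u v => (u, v) ∈ G.E)

/-- The cost `M_α(G) = Σ_{e ∈ E(G)} w(e)^α · length(e)`. -/
def cost (α : ℝ) (G : WDG m) : ℝ :=
  ∑ e ∈ G.E, (G.w e) ^ α * dist e.1 e.2

/-- Total weight of edges starting at `v`. -/
def outflow (G : WDG m) (v : Pt m) : ℝ :=
  ∑ e ∈ G.E.filter (fun e => e.1 = v), G.w e

/-- Total weight of edges ending at `v`. -/
def inflow (G : WDG m) (v : Pt m) : ℝ :=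
  ∑ e ∈ G.E.filter (fun e => e.2 = v), G.w e

end WDG

/-- Atomic measures are represented as finitely supported functions `ℝ^m →₀ ℝ`
with nonnegative values; `AtomicOn X c` also requires the atoms to lie in `X`. -/
def AtomicOn {m : ℕ} (X : Set (Pt m)) (c : Pt m →₀ ℝ) : Prop :=
  (∀ z, 0 ≤ c z) ∧ ↑c.support ⊆ X

/-- The mass `m(c)` of an atomic measure. -/
def massOf {m : ℕ} (c : Pt m →₀ ℝ) : ℝ := c.sum fun _ t => t

/-- `G` is a transport path from `a` to `b` inside `X`: its vertices lie in `X`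
and contain the atoms of `a` and `b`, its underlying undirected graph has no
cycles, and the balance equation holds at every vertex. -/
def IsTransportPath {m : ℕ} (X : Set (Pt m)) (G : WDG m) (a b : Pt m →₀ ℝ) : Prop :=
  G.edgesOK ∧ ↑G.V ⊆ X ∧
  (∀ z ∈ a.support, z ∈ G.V) ∧ (∀ z ∈ b.support, z ∈ G.V) ∧
  G.undirected.IsAcyclic ∧
  ∀ v : Pt m, G.outflow v - G.inflow v = a v - b v

/-- `d_α(a,b)`: the minimal cost of a transport path from `a` to `b`. -/
def dCost {m : ℕ} (X : Set (Pt m)) (α : ℝ) (a b : Pt m →₀ ℝ) : ℝ :=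
  sInf (WDG.cost α '' {G : WDG m | IsTransportPath X G a b})

/-- An optimal transport path from `a` to `b`. -/
def IsOptimalTP {m : ℕ} (X : Set (Pt m)) (α : ℝ) (G : WDG m) (a b : Pt m →₀ ℝ) : Prop :=
  IsTransportPath X G a b ∧
    ∀ G' : WDG m, IsTransportPath X G' a b → WDG.cost α G ≤ WDG.cost α G'

/-- The atomic probability measure `b = Σ_j n_j δ_{y_j}` of households. -/
def bMeas {m ℓ : ℕ} (y : Fin ℓ → Pt m) (n : Fin ℓ → ℝ) : Pt m →₀ ℝ :=
  ∑ j, Finsupp.single (y j) (n j)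

/-- An allocation path from the factory locations `x` to the households `(y,n)`:
a transport path to `b` from some atomic probability measure supported on the
factory locations. -/
def IsAllocPath {m k ℓ : ℕ} (X : Set (Pt m)) (x : Fin k → Pt m)
    (y : Fin ℓ → Pt m) (n : Fin ℓ → ℝ) (G : WDG m) : Prop :=
  ∃ a : Pt m →₀ ℝ, (∀ z, 0 ≤ a z) ∧ ↑a.support ⊆ Set.range x ∧ massOf a = 1 ∧
    IsTransportPath X G a (bMeas y n)

/-- An optimal allocation path: it minimizes `M_α` over all allocation paths. -/
def IsOptimalAllocPath {m k ℓ : ℕ} (X : Set (Pt m)) (α : ℝ) (x : Fin k → Pt m)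
    (y : Fin ℓ → Pt m) (n : Fin ℓ → ℝ) (G : WDG m) : Prop :=
  IsAllocPath X x y n G ∧
    ∀ G' : WDG m, IsAllocPath X x y n G' → WDG.cost α G ≤ WDG.cost α G'

/-- For an assignment map `S`, the part `b_i = Σ_{j : S(j) = i} n_j δ_{y_j}`. -/
def bPart {m k ℓ : ℕ} (y : Fin ℓ → Pt m) (n : Fin ℓ → ℝ) (S : Fin ℓ → Fin k)
    (i : Fin k) : Pt m →₀ ℝ :=
  ∑ j ∈ Finset.univ.filter (fun j => S j = i), Finsupp.single (y j) (n j)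

/-- The mass `m(b_i) = Σ_{j : S(j) = i} n_j`. -/
def mB {k ℓ : ℕ} (n : Fin ℓ → ℝ) (S : Fin ℓ → Fin k) (i : Fin k) : ℝ :=
  ∑ j ∈ Finset.univ.filter (fun j => S j = i), n j

/-- `E_α(S) = Σ_i d_α(m(b_i) δ_{x_i}, b_i)`. -/
def Ealpha {m k ℓ : ℕ} (X : Set (Pt m)) (α : ℝ) (x : Fin k → Pt m)
    (y : Fin ℓ → Pt m) (n : Fin ℓ → ℝ) (S : Fin ℓ → Fin k) : ℝ :=
  ∑ i, dCost X α (Finsupp.single (x i) (mB n S i)) (bPart y n S i)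

/-- An optimal assignment map minimizes `E_α` over all assignment maps. -/
def IsOptimalAssign {m k ℓ : ℕ} (X : Set (Pt m)) (α : ℝ) (x : Fin k → Pt m)
    (y : Fin ℓ → Pt m) (n : Fin ℓ → ℝ) (S : Fin ℓ → Fin k) : Prop :=
  ∀ S' : Fin ℓ → Fin k, Ealpha X α x y n S ≤ Ealpha X α x y n S'

/-- `ρ_α(σ,ε)`: equals `(σ/ε)^α − (σ/ε − 1)^α` for `σ > ε` (and for `σ = ε` when
`α ∈ (0,1)`), and equals `1` when `σ = ε` (covering also the convention for `α = 0`). -/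
def rho (α σ ε : ℝ) : ℝ :=
  if σ = ε then 1 else (σ / ε) ^ α - (σ / ε - 1) ^ α


/-- `G` is the disjoint union of the subgraphs `Gi`: the `Gi` have pairwise
disjoint vertex sets, each is a subgraph of `G` (with matching weights), and
the edges of `G` are exactly the (disjoint) union of their edges. -/
def IsDisjointUnion {m k : ℕ} (G : WDG m) (Gi : Fin k → WDG m) : Prop :=
  (∀ i i' : Fin k, i ≠ i' → Disjoint (Gi i).V (Gi i').V) ∧
  (∀ i, (Gi i).V ⊆ G.V) ∧
  (∀ i, (Gi i).E ⊆ G.E) ∧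
  (∀ i, ∀ e ∈ (Gi i).E, (Gi i).w e = G.w e) ∧
  G.E = Finset.univ.biUnion (fun i => (Gi i).E)

/-- The projection coordinate `π(z) = ⟨z − p, v⟩` along the line through `p`
in direction `v`. -/
def proj {m : ℕ} (p v z : Pt m) : ℝ := ⟪z - p, v⟫

/-- The constant `C = √(m−1)/(2^{1−(m−1)(1−α)} − 1) + 1`. -/
def Cconst (m : ℕ) (α : ℝ) : ℝ :=
  Real.sqrt ((m : ℝ) - 1) / ((2 : ℝ) ^ (1 - ((m : ℝ) - 1) * (1 - α)) - 1) + 1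


/-- The concave function `t ↦ t ^ α` on `[0, ∞)`, with value `0` at `0` even when `α = 0`. -/
def powCost (α t : ℝ) : ℝ := if t = 0 then 0 else t ^ α

section PowCost

variable {α : ℝ}

@[simp] lemma powCost_zero : powCost α 0 = 0 := if_pos rfl

lemma powCost_of_ne_zero {t : ℝ} (ht : t ≠ 0) : powCost α t = t ^ α := if_neg ht

lemma powCost_nonneg {t : ℝ} (ht : 0 ≤ t) : 0 ≤ powCost α t := by
  unfold powCost
  split_ifs
  exacts [le_rfl, Real.rpow_nonneg ht α]

lemma powCost_mono (hα : 0 ≤ α) {s t : ℝ} (hs : 0 ≤ s) (hst : s ≤ t) :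
    powCost α s ≤ powCost α t := by
  rcases hs.eq_or_lt with rfl | hs'
  · simpa using powCost_nonneg hst
  · rw [powCost_of_ne_zero hs'.ne', powCost_of_ne_zero (hs'.trans_le hst).ne']
    exact Real.rpow_le_rpow hs hst hα

lemma powCost_concaveOn (hα0 : 0 ≤ α) (hα1 : α ≤ 1) :
    ConcaveOn ℝ (Set.Ici 0) (powCost α) := by
  rcases hα0.eq_or_lt with rfl | hα
  · refine ⟨convex_Ici 0, ?_⟩
    intro x hx y hy a b ha hb hab
    simp only [Set.mem_Ici] at hx hy
    simp only [powCost, Real.rpow_zero, smul_eq_mul]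
    by_cases h : a * x + b * y = 0
    · have h1 : a * x = 0 := by nlinarith [mul_nonneg ha hx, mul_nonneg hb hy]
      have h2 : b * y = 0 := by nlinarith [mul_nonneg ha hx, mul_nonneg hb hy]
      rcases mul_eq_zero.1 h1 with h1 | h1 <;> rcases mul_eq_zero.1 h2 with h2 | h2 <;>
        simp [h1, h2]
    · rw [if_neg h]
      split_ifs <;> nlinarith
  · have h : powCost α = fun t : ℝ => t ^ α := by
      ext t
      by_cases ht : t = 0
      · simp [ht, Real.zero_rpow hα.ne']
      · exact powCost_of_ne_zero ht
    rw [h]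
    exact Real.concaveOn_rpow hα0 hα1

lemma mul_powCost_le (hα0 : 0 ≤ α) (hα1 : α ≤ 1) {s t : ℝ} (hs : 0 ≤ s) (hst : s ≤ t) :
    s * powCost α t ≤ t * powCost α s := by
  rcases (hs.trans hst).eq_or_lt with rfl | ht
  · simp [le_antisymm hst hs]
  · have h := (powCost_concaveOn hα0 hα1).2 (Set.mem_Ici.2 ht.le) (Set.mem_Ici.2 le_rfl)
      (div_nonneg hs ht.le) (sub_nonneg.2 ((div_le_one ht).2 hst)) (add_sub_cancel _ _)
    simp only [smul_eq_mul, powCost_zero, mul_zero, add_zero, div_mul_cancel₀ s ht.ne'] at h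
    rwa [div_mul_eq_mul_div, div_le_iff₀ ht, mul_comm (powCost α s)] at h

lemma powCost_add_le (hα0 : 0 ≤ α) (hα1 : α ≤ 1) {s t : ℝ} (hs : 0 ≤ s) (ht : 0 ≤ t) :
    powCost α (s + t) ≤ powCost α s + powCost α t := by
  have h1 := mul_powCost_le hα0 hα1 hs (le_add_of_nonneg_right ht)
  have h2 := mul_powCost_le hα0 hα1 ht (le_add_of_nonneg_left hs)
  rcases (add_nonneg hs ht).eq_or_lt with h | h
  · rw [← h, powCost_zero]
    exact add_nonneg (powCost_nonneg hs) (powCost_nonneg ht)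
  · nlinarith

lemma sum_powCost_le {ι : Type*} [Fintype ι] [Nonempty ι] (hα0 : 0 ≤ α) (hα1 : α ≤ 1)
    {t : ι → ℝ} (ht : ∀ i, 0 ≤ t i) :
    ∑ i, powCost α (t i) ≤ (Fintype.card ι : ℝ) ^ (1 - α) * powCost α (∑ i, t i) := by
  set N : ℝ := ((Fintype.card ι : ℕ) : ℝ) with hN
  have hN0 : 0 < N := by simp [hN, Fintype.card_pos]
  have h := (powCost_concaveOn hα0 hα1).le_map_sum (t := Finset.univ) (w := fun _ : ι => N⁻¹)
    (p := t) (fun _ _ => inv_nonneg.2 hN0.le) (by simp [← hN, hN0.ne']) (fun i _ => ht i)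
  simp only [smul_eq_mul, ← Finset.mul_sum] at h
  have hS : 0 ≤ ∑ i, t i := Finset.sum_nonneg fun i _ => ht i
  rcases hS.eq_or_lt with hS' | hS'
  · rw [← hS', mul_zero, powCost_zero] at h
    rw [← hS', powCost_zero, mul_zero]
    exact nonpos_of_mul_nonpos_right h (inv_pos.2 hN0)
  · rw [powCost_of_ne_zero (mul_pos (inv_pos.2 hN0) hS').ne', Real.mul_rpow
      (inv_nonneg.2 hN0.le) hS, inv_mul_le_iff₀ hN0] at h
    rw [powCost_of_ne_zero hS'.ne', sub_eq_add_neg, Real.rpow_add hN0, Real.rpow_one,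
      Real.rpow_neg hN0.le, ← Real.inv_rpow hN0.le, mul_assoc]
    exact h

end PowCost

/-- The divergence (outflow minus inflow) of a finitely supported function on directed edges. -/
def divergence {V : Type*} : (V × V →₀ ℝ) →ₗ[ℝ] (V →₀ ℝ) :=
  Finsupp.lmapDomain ℝ ℝ Prod.fst - Finsupp.lmapDomain ℝ ℝ Prod.snd

/-- The `α`-cost of a finitely supported flow whose edges have lengths `len`. -/
def flowCost {ι : Type*} (α : ℝ) (len : ι → ℝ) (f : ι →₀ ℝ) : ℝ :=
  f.sum fun e t => powCost α t * len e

section Divergence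

variable {V W : Type*}

lemma divergence_apply (f : V × V →₀ ℝ) :
    divergence f = f.mapDomain Prod.fst - f.mapDomain Prod.snd := rfl

@[simp] lemma divergence_single (u v : V) (t : ℝ) :
    divergence (Finsupp.single (u, v) t) = Finsupp.single u t - Finsupp.single v t := by
  simp [divergence_apply, Finsupp.mapDomain_single]

lemma linearCombination_divergence (ψ : V → ℝ) (f : V × V →₀ ℝ) :
    Finsupp.linearCombination ℝ ψ (divergence f) =
      f.sum fun e t => t * (ψ e.1 - ψ e.2) := by
  rw [divergence_apply, map_sub, Finsupp.linearCombination_mapDomain,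
    Finsupp.linearCombination_mapDomain, Finsupp.linearCombination_apply,
    Finsupp.linearCombination_apply, ← Finsupp.sum_sub]
  simp [mul_sub]

lemma divergence_mapDomain (T : V → W) (f : V × V →₀ ℝ) :
    divergence (f.mapDomain (Prod.map T T)) = (divergence f).mapDomain T := by
  have h := map_sub (Finsupp.lmapDomain ℝ ℝ T) (f.mapDomain Prod.fst) (f.mapDomain Prod.snd)
  simp only [Finsupp.lmapDomain_apply] at h
  rw [divergence_apply, divergence_apply, h]
  simp only [← Finsupp.mapDomain_comp]
  rfl

lemma massOf_divergence {m : ℕ} (f : Pt m × Pt m →₀ ℝ) : massOf (divergence f) = 0 := by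
  have h := linearCombination_divergence (fun _ : Pt m => (1 : ℝ)) f
  simpa [Finsupp.linearCombination_apply, massOf, Finsupp.sum] using h

end Divergence

section FlowCost

variable {ι κ : Type*} {α : ℝ}

lemma flowCost_eq_sum {len : ι → ℝ} {f : ι →₀ ℝ} {s : Finset ι} (h : f.support ⊆ s) :
    flowCost α len f = ∑ e ∈ s, powCost α (f e) * len e :=
  Finsupp.sum_of_support_subset _ h _ (by simp)

@[simp] lemma flowCost_zero (len : ι → ℝ) : flowCost α len 0 = 0 := Finsupp.sum_zero_index

@[simp] lemma flowCost_single (len : ι → ℝ) (e : ι) (t : ℝ) :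
    flowCost α len (Finsupp.single e t) = powCost α t * len e :=
  Finsupp.sum_single_index (by simp)

lemma flowCost_mono (hα : 0 ≤ α) {len : ι → ℝ} (hlen : ∀ e, 0 ≤ len e) {f g : ι →₀ ℝ}
    (hf : 0 ≤ f) (hfg : f ≤ g) : flowCost α len f ≤ flowCost α len g := by
  rw [flowCost_eq_sum (Finset.subset_union_left (s₂ := g.support)),
    flowCost_eq_sum (f := g) (Finset.subset_union_right (s₁ := f.support))]
  exact Finset.sum_le_sum fun e _ =>
    mul_le_mul_of_nonneg_right (powCost_mono hα (hf e) (hfg e)) (hlen e)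

lemma flowCost_add_le (hα0 : 0 ≤ α) (hα1 : α ≤ 1) {len : ι → ℝ} (hlen : ∀ e, 0 ≤ len e)
    {f g : ι →₀ ℝ} (hf : 0 ≤ f) (hg : 0 ≤ g) :
    flowCost α len (f + g) ≤ flowCost α len f + flowCost α len g := by
  rw [flowCost_eq_sum (f := f) (Finset.subset_union_left (s₂ := g.support)),
    flowCost_eq_sum (f := g) (Finset.subset_union_right (s₁ := f.support)),
    flowCost_eq_sum (Finsupp.support_add (g₁ := f) (g₂ := g)), ← Finset.sum_add_distrib]
  refine Finset.sum_le_sum fun e _ => ?_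
  rw [← add_mul]
  exact mul_le_mul_of_nonneg_right (powCost_add_le hα0 hα1 (hf e) (hg e)) (hlen e)

lemma flowCost_sum_le (hα0 : 0 ≤ α) (hα1 : α ≤ 1) {len : ι → ℝ} (hlen : ∀ e, 0 ≤ len e)
    {f : κ → ι →₀ ℝ} (s : Finset κ) (hf : ∀ k ∈ s, 0 ≤ f k) :
    flowCost α len (∑ k ∈ s, f k) ≤ ∑ k ∈ s, flowCost α len (f k) := by
  induction s using Finset.induction_on with
  | empty => simp
  | insert k s hk ih =>
    rw [Finset.sum_insert hk, Finset.sum_insert hk]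
    have h0 : ∀ i ∈ s, 0 ≤ f i := fun i hi => hf i (Finset.mem_insert_of_mem hi)
    exact (flowCost_add_le hα0 hα1 hlen (hf k (Finset.mem_insert_self k s))
      (Finset.sum_nonneg h0)).trans (add_le_add_right (ih h0) _)

lemma flowCost_mapDomain_le (hα0 : 0 ≤ α) (hα1 : α ≤ 1) {len : κ → ℝ} (hlen : ∀ e, 0 ≤ len e)
    (F : ι → κ) {f : ι →₀ ℝ} (hf : 0 ≤ f) :
    flowCost α len (f.mapDomain F) ≤ flowCost α (fun e => len (F e)) f := by
  have h := flowCost_sum_le hα0 hα1 hlen (f := fun e => Finsupp.single (F e) (f e)) f.support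
    (fun e _ => Finsupp.single_nonneg.2 (hf e))
  simp only [flowCost_single] at h
  exact h

end FlowCost

/-- A flow is circulation-free if its support carries no nonzero signed circulation. -/
def CirculationFree {V : Type*} (f : V × V →₀ ℝ) : Prop :=
  ∀ h : V × V →₀ ℝ, h.support ⊆ f.support → divergence h = 0 → h = 0

section CycleRemoval

lemma exists_add_smul_vanishing {ι : Type*} {f h : ι →₀ ℝ} (hf : 0 ≤ f)
    (hsupp : h.support ⊆ f.support) (hneg : ∃ e, h e < 0) :
    ∃ t : ℝ, 0 < t ∧ 0 ≤ f + t • h ∧ (f + t • h).support ⊂ f.support := by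
  have hne : (f.support.filter fun e => h e < 0).Nonempty := by
    obtain ⟨e, he⟩ := hneg
    exact ⟨e, Finset.mem_filter.2 ⟨hsupp (Finsupp.mem_support_iff.2 he.ne), he⟩⟩
  obtain ⟨e₀, he₀, hmin⟩ := Finset.exists_min_image _ (fun e => f e / -h e) hne
  obtain ⟨hs₀, hn₀⟩ := Finset.mem_filter.1 he₀
  have hpos₀ : 0 < f e₀ := lt_of_le_of_ne (hf e₀) (Finsupp.mem_support_iff.1 hs₀).symm
  have ht : 0 < f e₀ / -h e₀ := div_pos hpos₀ (neg_pos.2 hn₀)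
  refine ⟨f e₀ / -h e₀, ht, fun e => ?_, ?_⟩
  · rw [Finsupp.add_apply, Finsupp.smul_apply, smul_eq_mul, Finsupp.zero_apply]
    rcases lt_or_ge (h e) 0 with he | he
    · have h1 := hmin e (Finset.mem_filter.2 ⟨hsupp (Finsupp.mem_support_iff.2 he.ne), he⟩)
      rw [le_div_iff₀ (neg_pos.2 he)] at h1
      linarith
    · exact add_nonneg (hf e) (mul_nonneg ht.le he)
  · refine (Finset.ssubset_iff_of_subset ?_).2 ⟨e₀, hs₀, ?_⟩
    · exact Finsupp.support_add.trans
        (Finset.union_subset subset_rfl (Finsupp.support_smul.trans hsupp))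
    · rw [Finsupp.notMem_support_iff, Finsupp.add_apply, Finsupp.smul_apply, smul_eq_mul]
      field_simp [hn₀.ne]
      ring

variable {V : Type*} {α : ℝ}

lemma min_flowCost_le {ι : Type*} (hα0 : 0 ≤ α) (hα1 : α ≤ 1) {len : ι → ℝ}
    (hlen : ∀ e, 0 ≤ len e) {f h : ι →₀ ℝ} {s t : ℝ} (hs : 0 < s) (ht : 0 < t)
    (hfs : 0 ≤ f + s • h) (hft : 0 ≤ f + t • (-h)) :
    min (flowCost α len (f + s • h)) (flowCost α len (f + t • (-h))) ≤ flowCost α len f := by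
  set S := f.support ∪ h.support with hS
  have hst : 0 < s + t := add_pos hs ht
  have h1 : (f + s • h).support ⊆ S := Finsupp.support_add.trans
    (Finset.union_subset_union subset_rfl Finsupp.support_smul)
  have h2 : (f + t • (-h)).support ⊆ S := Finsupp.support_add.trans
    (Finset.union_subset_union subset_rfl (Finsupp.support_smul.trans (by simp)))
  have key : t / (s + t) * flowCost α len (f + s • h) +
      s / (s + t) * flowCost α len (f + t • (-h)) ≤ flowCost α len f := by
    rw [flowCost_eq_sum h1, flowCost_eq_sum h2,
      flowCost_eq_sum (f := f) (Finset.subset_union_left (s₂ := h.support)), Finset.mul_sum,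
      Finset.mul_sum, ← Finset.sum_add_distrib]
    refine Finset.sum_le_sum fun e _ => ?_
    have hc := (powCost_concaveOn hα0 hα1).2 (hfs e) (hft e) (div_nonneg ht.le hst.le)
      (div_nonneg hs.le hst.le) (by field_simp; ring)
    have he : (t / (s + t)) • (f + s • h) e + (s / (s + t)) • (f + t • (-h)) e = f e := by
      simp only [Finsupp.add_apply, Finsupp.smul_apply, Finsupp.neg_apply, smul_eq_mul]
      field_simp
      ring
    rw [he, smul_eq_mul, smul_eq_mul] at hc
    nlinarith [mul_le_mul_of_nonneg_right hc (hlen e)]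
  refine le_trans ?_ key
  have hsum : t / (s + t) + s / (s + t) = 1 := by field_simp; ring
  have h3 := mul_le_mul_of_nonneg_left (min_le_left (flowCost α len (f + s • h))
    (flowCost α len (f + t • (-h)))) (div_nonneg ht.le hst.le)
  have h4 := mul_le_mul_of_nonneg_left (min_le_right (flowCost α len (f + s • h))
    (flowCost α len (f + t • (-h)))) (div_nonneg hs.le hst.le)
  calc _ = (t / (s + t) + s / (s + t)) * min (flowCost α len (f + s • h))
        (flowCost α len (f + t • (-h))) := by rw [hsum, one_mul]
    _ ≤ _ := by rw [add_mul]; exact add_le_add h3 h4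

lemma exists_smaller_support (hα0 : 0 ≤ α) (hα1 : α ≤ 1) {len : V × V → ℝ}
    (hlen : ∀ e, 0 ≤ len e) {f : V × V →₀ ℝ} (hf : 0 ≤ f) (hcirc : ¬ CirculationFree f) :
    ∃ g : V × V →₀ ℝ, 0 ≤ g ∧ g.support ⊂ f.support ∧ divergence g = divergence f ∧
      flowCost α len g ≤ flowCost α len f := by
  simp only [CirculationFree, not_forall] at hcirc
  obtain ⟨h, hsupp, hdiv, hne⟩ := hcirc
  have hsupp' : (-h).support ⊆ f.support := by rwa [Finsupp.support_neg]
  have hd : ∀ t : ℝ, divergence (f + t • h) = divergence f := fun t => by simp [hdiv]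
  have hd' : ∀ t : ℝ, divergence (f + t • (-h)) = divergence f := fun t => by simp [hdiv]
  have step : ∀ {k : V × V →₀ ℝ}, k.support ⊆ f.support → divergence k = 0 → k ≠ 0 → k ≤ 0 →
      ∃ g : V × V →₀ ℝ, 0 ≤ g ∧ g.support ⊂ f.support ∧ divergence g = divergence f ∧
      flowCost α len g ≤ flowCost α len f := by
    intro k hk hdk hk0 hkn
    obtain ⟨e, he⟩ := Finsupp.ne_iff.1 hk0
    obtain ⟨t, ht, h0, hs⟩ := exists_add_smul_vanishing hf hk ⟨e, lt_of_le_of_ne (hkn e) he⟩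
    refine ⟨f + t • k, h0, hs, by simp [hdk], flowCost_mono hα0 hlen h0 fun e => ?_⟩
    have := hkn e
    simp only [Finsupp.add_apply, Finsupp.smul_apply, smul_eq_mul, Finsupp.zero_apply] at this ⊢
    nlinarith
  by_cases hn : ∃ e, h e < 0
  · by_cases hp : ∃ e, (-h) e < 0
    · obtain ⟨s, hs, hs0, hss⟩ := exists_add_smul_vanishing hf hsupp hn
      obtain ⟨t, ht, ht0, hts⟩ := exists_add_smul_vanishing hf hsupp' hp
      rcases min_le_iff.1 (min_flowCost_le hα0 hα1 hlen hs ht hs0 ht0) with hle | hle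
      · exact ⟨_, hs0, hss, hd s, hle⟩
      · exact ⟨_, ht0, hts, hd' t, hle⟩
    · push Not at hp
      refine step hsupp hdiv hne fun e => ?_
      have := hp e
      simp only [Finsupp.neg_apply, Finsupp.zero_apply] at this ⊢
      linarith
  · push Not at hn
    refine step hsupp' (by simp [hdiv]) (neg_ne_zero.2 hne) fun e => ?_
    have := hn e
    simp only [Finsupp.neg_apply, Finsupp.zero_apply] at this ⊢
    linarith

lemma exists_circulationFree (hα0 : 0 ≤ α) (hα1 : α ≤ 1) {len : V × V → ℝ}
    (hlen : ∀ e, 0 ≤ len e) {f : V × V →₀ ℝ} (hf : 0 ≤ f) :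
    ∃ g : V × V →₀ ℝ, 0 ≤ g ∧ g.support ⊆ f.support ∧ divergence g = divergence f ∧
      flowCost α len g ≤ flowCost α len f ∧ CirculationFree g := by
  induction hn : f.support.card using Nat.strong_induction_on generalizing f with
  | _ n ih =>
    by_cases hcf : CirculationFree f
    · exact ⟨f, hf, subset_rfl, rfl, le_rfl, hcf⟩
    · obtain ⟨g, hg0, hgs, hgd, hgc⟩ := exists_smaller_support hα0 hα1 hlen hf hcf
      obtain ⟨k, hk0, hks, hkd, hkc, hkcf⟩ :=
        ih _ (hn ▸ Finset.card_lt_card hgs) hg0 rfl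
      exact ⟨k, hk0, hks.trans hgs.1, hkd.trans hgd, hkc.trans hgc, hkcf⟩

lemma CirculationFree.ne {f : V × V →₀ ℝ} (hf : CirculationFree f) {e : V × V}
    (he : e ∈ f.support) : e.1 ≠ e.2 := by
  intro h
  have h0 := hf (Finsupp.single e 1) (Finsupp.support_single_subset.trans (by simpa using he))
    (by rw [← Prod.mk.eta (p := e), divergence_single, h, sub_self])
  simp at h0

/-- In a circulation-free flow, every edge weight is at most the total demand. -/
lemma CirculationFree.apply_le {f : V × V →₀ ℝ} (hf : CirculationFree f) {M : ℝ}
    (hM : ∀ s : Set V, -M ≤ Finsupp.linearCombination ℝ (s.indicator 1) (divergence f))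
    (e : V × V) : f e ≤ M := by
  by_cases he : e ∈ f.support
  swap
  · rw [Finsupp.notMem_support_iff.1 he]
    simpa [Finsupp.linearCombination_apply] using hM ∅
  let S : Set V := {z | ∃ h : V × V →₀ ℝ, h.support ⊆ f.support ∧ h e = 0 ∧
    divergence h = Finsupp.single z 1 - Finsupp.single e.2 1}
  have hy : e.2 ∈ S := ⟨0, by simp, by simp, by simp⟩
  have hx : e.1 ∉ S := by
    rintro ⟨h, hs, h0, hd⟩
    have h1 := hf (h - Finsupp.single e 1) (Finsupp.support_sub.trans (Finset.union_subset hs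
      (Finsupp.support_single_subset.trans (by simpa using he))))
      (by rw [map_sub, hd, ← Prod.mk.eta (p := e), divergence_single, sub_self])
    have h2 := DFunLike.congr_fun h1 e
    simp [h0] at h2
  have hstep : ∀ e' ∈ f.support, e' ≠ e → (e'.1 ∈ S ↔ e'.2 ∈ S) := by
    intro e' he' hne
    have hsub : (Finsupp.single e' (1 : ℝ)).support ⊆ f.support :=
      Finsupp.support_single_subset.trans (by simpa using he')
    have hd' : divergence (Finsupp.single e' (1 : ℝ)) =
        Finsupp.single e'.1 1 - Finsupp.single e'.2 1 := by
      rw [← Prod.mk.eta (p := e'), divergence_single]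
    constructor
    · rintro ⟨h, hs, h0, hd⟩
      refine ⟨h - Finsupp.single e' 1, Finsupp.support_sub.trans (Finset.union_subset hs hsub),
        by simp [h0, hne], ?_⟩
      rw [map_sub, hd, hd']
      abel
    · rintro ⟨h, hs, h0, hd⟩
      refine ⟨h + Finsupp.single e' 1, Finsupp.support_add.trans (Finset.union_subset hs hsub),
        by simp [h0, hne], ?_⟩
      rw [map_add, hd, hd']
      abel
  have h1 := hM S
  rw [linearCombination_divergence, Finsupp.sum, Finset.sum_eq_single_of_mem e he] at h1
  · simp only [Set.indicator_of_mem hy, Set.indicator_of_notMem hx, Pi.one_apply] at h1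
    linarith
  · intro e' he' hne
    by_cases h2 : e'.2 ∈ S
    · simp [Set.indicator_of_mem h2, Set.indicator_of_mem ((hstep e' he' hne).2 h2)]
    · simp [Set.indicator_of_notMem h2,
        Set.indicator_of_notMem (fun h => h2 ((hstep e' he' hne).1 h))]

lemma exists_flow_of_reachable {G : SimpleGraph V} {E : Finset (V × V)}
    (hG : ∀ u v, G.Adj u v → (u, v) ∈ E ∨ (v, u) ∈ E) {u v : V} (h : G.Reachable u v) :
    ∃ f : V × V →₀ ℝ, (∀ e ∈ f.support, e ∈ E ∧ G.Adj e.1 e.2) ∧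
      divergence f = Finsupp.single u 1 - Finsupp.single v 1 := by
  obtain ⟨p⟩ := h
  induction p with
  | nil => exact ⟨0, by simp, by simp⟩
  | @cons a b c hab p ih =>
    obtain ⟨f, hf, hd⟩ := ih
    rcases hG a b hab with hE | hE
    · refine ⟨Finsupp.single (a, b) 1 + f, fun e he => ?_, by rw [map_add, hd]; simp⟩
      rcases Finset.mem_union.1 (Finsupp.support_add he) with h | h
      · obtain rfl := Finset.mem_singleton.1 (Finsupp.support_single_subset h)
        exact ⟨hE, hab⟩
      · exact hf e h
    · refine ⟨f - Finsupp.single (b, a) 1, fun e he => ?_, by rw [map_sub, hd]; simp⟩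
      rcases Finset.mem_union.1 (Finsupp.support_sub he) with h | h
      · exact hf e h
      · obtain rfl := Finset.mem_singleton.1 (Finsupp.support_single_subset h)
        exact ⟨hE, hab.symm⟩

lemma CirculationFree.isAcyclic {f : V × V →₀ ℝ} (hf : CirculationFree f) :
    (SimpleGraph.fromRel fun u v => (u, v) ∈ f.support).IsAcyclic := by
  set G := SimpleGraph.fromRel fun u v => (u, v) ∈ f.support with hG
  rw [SimpleGraph.isAcyclic_iff_forall_isBridge]
  intro e he
  have main : ∀ u v : V, (u, v) ∈ f.support → ¬ (G.deleteEdges {s(u, v)}).Reachable u v := by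
    intro u v huv hr
    obtain ⟨h, hs, hd⟩ := exists_flow_of_reachable (E := f.support) (fun a b hab => by
      have := (SimpleGraph.deleteEdges_le _ hab : G.Adj a b)
      rw [hG, SimpleGraph.fromRel_adj] at this
      exact this.2) hr
    have h1 := hf (h - Finsupp.single (u, v) 1) (Finsupp.support_sub.trans (Finset.union_subset
      (fun e he => (hs e he).1) (Finsupp.support_single_subset.trans (by simpa using huv))))
      (by rw [map_sub, hd, divergence_single, sub_self])
    have h2 : h (u, v) = 0 := by
      by_contra h2
      have := (hs _ (Finsupp.mem_support_iff.2 h2)).2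
      simp [SimpleGraph.deleteEdges_adj] at this
    have h3 := DFunLike.congr_fun h1 (u, v)
    simp [h2] at h3
  induction e with
  | _ u v =>
    rw [SimpleGraph.isBridge_iff]
    rw [SimpleGraph.mem_edgeSet, hG, SimpleGraph.fromRel_adj] at he
    rcases he.2 with h | h
    · exact main u v h
    · intro hr
      refine main v u h ?_
      rw [Sym2.eq_swap]
      exact hr.symm

end CycleRemoval

section TransportPaths

lemma mapDomain_apply_eq_sum_filter {ι κ : Type*} (F : ι → κ) {f : ι →₀ ℝ} {s : Finset ι}
    (hs : f.support ⊆ s) (v : κ) :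
    f.mapDomain F v = ∑ e ∈ s.filter (fun e => F e = v), f e := by
  rw [Finsupp.mapDomain, Finsupp.sum_of_support_subset _ hs _ (by simp), Finsupp.finsetSum_apply,
    Finset.sum_filter]
  exact Finset.sum_congr rfl fun e _ => by rw [Finsupp.single_apply]

/-- The length of a directed segment. -/
def edgeLength {F : Type*} [PseudoMetricSpace F] (e : F × F) : ℝ := dist e.1 e.2

lemma edgeLength_nonneg {F : Type*} [PseudoMetricSpace F] (e : F × F) : 0 ≤ edgeLength e :=
  dist_nonneg

lemma exists_convex_retraction {F : Type*} [NormedAddCommGroup F] [InnerProductSpace ℝ F]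
    {K : Set F} (hne : K.Nonempty) (hK : IsComplete K) (hconv : Convex ℝ K) :
    ∃ r : F → F, (∀ z, r z ∈ K) ∧ (∀ z ∈ K, r z = z) ∧ ∀ z w, dist (r z) (r w) ≤ dist z w := by
  choose r hrK hr using exists_norm_eq_iInf_of_complete_convex hne hK hconv
  have hin : ∀ z, ∀ w ∈ K, ⟪z - r z, w - r z⟫ ≤ 0 := fun z =>
    (norm_eq_iInf_iff_real_inner_le_zero hconv (hrK z)).1 (hr z)
  refine ⟨r, hrK, fun z hz => ?_, fun z w => ?_⟩
  · have h := hin z z hz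
    rw [real_inner_self_eq_norm_sq] at h
    have h2 : ‖z - r z‖ = 0 := by nlinarith [sq_nonneg ‖z - r z‖]
    exact (sub_eq_zero.1 (norm_eq_zero.1 h2)).symm
  · have h1 := hin z (r w) (hrK w)
    have h2 := hin w (r z) (hrK z)
    have h3 : ⟪r z - r w, r z - r w⟫ ≤ ⟪z - w, r z - r w⟫ := by
      have e : ⟪z - w, r z - r w⟫ - ⟪r z - r w, r z - r w⟫ =
          -⟪z - r z, r w - r z⟫ - ⟪w - r w, r z - r w⟫ := by
        simp only [inner_sub_left, inner_sub_right, real_inner_comm (r w) (r z)]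
        ring
      linarith
    rw [real_inner_self_eq_norm_sq] at h3
    have h4 := h3.trans (real_inner_le_norm _ _)
    rw [dist_eq_norm, dist_eq_norm]
    by_contra hlt
    push Not at hlt
    nlinarith [norm_nonneg (z - w), norm_nonneg (r z - r w)]

variable {m : ℕ} {X : Set (Pt m)} {α : ℝ}

lemma IsTransportPath.cost_nonneg {G : WDG m} {a b : Pt m →₀ ℝ} (hG : IsTransportPath X G a b) :
    0 ≤ G.cost α :=
  Finset.sum_nonneg fun e he =>
    mul_nonneg (Real.rpow_nonneg (hG.1 e he).2.2.2.le α) dist_nonneg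

lemma bddBelow_cost (a b : Pt m →₀ ℝ) :
    BddBelow (WDG.cost α '' {G : WDG m | IsTransportPath X G a b}) := by
  refine ⟨0, ?_⟩
  rintro _ ⟨G, hG, rfl⟩
  exact hG.cost_nonneg

lemma exists_transportPath (hα0 : 0 ≤ α) (hα1 : α ≤ 1) {a b : Pt m →₀ ℝ}
    (ha : ↑a.support ⊆ X) (hb : ↑b.support ⊆ X) {f : Pt m × Pt m →₀ ℝ} (hf : 0 ≤ f)
    (hfX : ∀ e ∈ f.support, e.1 ∈ X ∧ e.2 ∈ X) (hdiv : divergence f = a - b) :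
    ∃ G : WDG m, IsTransportPath X G a b ∧ G.cost α ≤ flowCost α edgeLength f := by
  obtain ⟨g, hg0, hgs, hgd, hgc, hcf⟩ :=
    exists_circulationFree hα0 hα1 edgeLength_nonneg hf
  have hpos : ∀ e ∈ g.support, 0 < g e := fun e he =>
    lt_of_le_of_ne (hg0 e) (Finsupp.mem_support_iff.1 he).symm
  refine ⟨⟨g.support.image Prod.fst ∪ g.support.image Prod.snd ∪ (a.support ∪ b.support),
    g.support, g⟩, ⟨fun e he => ⟨?_, ?_, hcf.ne he, hpos e he⟩, ?_, ?_, ?_, hcf.isAcyclic,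
    fun v => ?_⟩, ?_⟩
  · exact Finset.mem_union_left _ (Finset.mem_union_left _ (Finset.mem_image_of_mem _ he))
  · exact Finset.mem_union_left _ (Finset.mem_union_right _ (Finset.mem_image_of_mem _ he))
  · intro z hz
    simp only [Finset.coe_union, Finset.coe_image, Set.mem_union, Set.mem_image] at hz
    rcases hz with (⟨e, he, rfl⟩ | ⟨e, he, rfl⟩) | hz | hz
    · exact (hfX e (hgs he)).1
    · exact (hfX e (hgs he)).2
    · exact ha hz
    · exact hb hz
  · exact fun z hz => Finset.mem_union_right _ (Finset.mem_union_left _ hz)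
  · exact fun z hz => Finset.mem_union_right _ (Finset.mem_union_right _ hz)
  · rw [← Finsupp.sub_apply, ← hdiv, ← hgd, divergence_apply, Finsupp.sub_apply,
      mapDomain_apply_eq_sum_filter _ subset_rfl, mapDomain_apply_eq_sum_filter _ subset_rfl]
    simp only [WDG.outflow, WDG.inflow]
    congr!
  · refine le_trans (le_of_eq ?_) hgc
    exact Finset.sum_congr rfl fun e he => by
      simp only [powCost_of_ne_zero (hpos e he).ne', edgeLength]

lemma flowCost_mapDomain_le_of_contracting {F F' : Type*} [PseudoMetricSpace F]
    [PseudoMetricSpace F'] (hα0 : 0 ≤ α) (hα1 : α ≤ 1) {T : F → F'}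
    (hT : ∀ z w, dist (T z) (T w) ≤ dist z w) {f : F × F →₀ ℝ} (hf : 0 ≤ f) :
    flowCost α edgeLength (f.mapDomain (Prod.map T T)) ≤ flowCost α edgeLength f :=
  (flowCost_mapDomain_le hα0 hα1 edgeLength_nonneg _ hf).trans <| Finset.sum_le_sum fun e _ =>
    mul_le_mul_of_nonneg_left (hT e.1 e.2) (powCost_nonneg (hf e))

lemma mapDomain_eq_self {ι : Type*} {T : ι → ι} {a : ι →₀ ℝ} (h : ∀ z ∈ a.support, T z = z) :
    a.mapDomain T = a := by
  conv_rhs => rw [← Finsupp.mapDomain_id (v := a)]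
  exact Finsupp.mapDomain_congr h

lemma exists_transportPath_of_convex (hXc : IsCompact X) (hXconv : Convex ℝ X)
    (hne : X.Nonempty) (hα0 : 0 ≤ α) (hα1 : α ≤ 1) {a b : Pt m →₀ ℝ}
    (ha : ↑a.support ⊆ X) (hb : ↑b.support ⊆ X) {f : Pt m × Pt m →₀ ℝ} (hf : 0 ≤ f)
    (hdiv : divergence f = a - b) :
    ∃ G : WDG m, IsTransportPath X G a b ∧ G.cost α ≤ flowCost α edgeLength f := by
  obtain ⟨r, hrX, hrid, hrc⟩ := exists_convex_retraction hne hXc.isComplete hXconv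
  obtain ⟨G, hG, hGc⟩ := exists_transportPath hα0 hα1 ha hb
    (Finsupp.mapDomain_nonneg (f := Prod.map r r) hf) (fun e he => by
      obtain ⟨e', -, rfl⟩ := Finset.mem_image.1 (Finsupp.mapDomain_support he)
      exact ⟨hrX _, hrX _⟩)
    (by rw [divergence_mapDomain, hdiv, Finsupp.mapDomain_sub,
      mapDomain_eq_self fun z hz => hrid z (ha hz), mapDomain_eq_self fun z hz => hrid z (hb hz)])
  exact ⟨G, hG, hGc.trans (flowCost_mapDomain_le_of_contracting hα0 hα1 hrc hf)⟩

lemma dCost_le_flowCost (hXc : IsCompact X) (hXconv : Convex ℝ X)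
    (hne : X.Nonempty) (hα0 : 0 ≤ α) (hα1 : α ≤ 1) {a b : Pt m →₀ ℝ}
    (ha : ↑a.support ⊆ X) (hb : ↑b.support ⊆ X) {f : Pt m × Pt m →₀ ℝ} (hf : 0 ≤ f)
    (hdiv : divergence f = a - b) : dCost X α a b ≤ flowCost α edgeLength f := by
  obtain ⟨G, hG, hGc⟩ :=
    exists_transportPath_of_convex hXc hXconv hne hα0 hα1 ha hb hf hdiv
  exact (csInf_le (bddBelow_cost a b) ⟨G, hG, rfl⟩).trans hGc

lemma IsTransportPath.exists_flow {G : WDG m} {a b : Pt m →₀ ℝ}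
    (hG : IsTransportPath X G a b) :
    ∃ f : Pt m × Pt m →₀ ℝ, 0 ≤ f ∧ divergence f = a - b ∧
      flowCost α edgeLength f = G.cost α := by
  set f : Pt m × Pt m →₀ ℝ := Finsupp.indicator G.E fun e _ => G.w e with hf
  have hfE : ∀ e ∈ G.E, f e = G.w e := fun e he => Finsupp.indicator_of_mem he _
  have hsupp : f.support ⊆ G.E := Finsupp.support_indicator_subset _ _
  refine ⟨f, fun e => ?_, ?_, ?_⟩
  · by_cases he : e ∈ G.E
    · rw [hfE e he]
      exact (hG.1 e he).2.2.2.le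
    · rw [Finsupp.notMem_support_iff.1 fun h => he (hsupp h)]
      exact le_rfl
  · ext v
    rw [Finsupp.sub_apply, ← hG.2.2.2.2.2 v, divergence_apply, Finsupp.sub_apply,
      mapDomain_apply_eq_sum_filter _ hsupp, mapDomain_apply_eq_sum_filter _ hsupp,
      WDG.outflow, WDG.inflow]
    congr 1 <;> exact Finset.sum_congr (by congr!) fun e he => hfE e (Finset.mem_filter.1 he).1
  · rw [flowCost_eq_sum hsupp, WDG.cost]
    exact Finset.sum_congr rfl fun e he => by
      rw [hfE e he, powCost_of_ne_zero (hG.1 e he).2.2.2.ne', edgeLength]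

end TransportPaths

section FirstHitting

variable {V : Type*}

/-- A flow whose sources outside `H` are nonnegative contains a subflow with the same divergence
outside `H` and no edge leaving `H`: the part of the flow that has not yet visited `H`. -/
lemma exists_subflow_stopped (H : Set V) {f : V × V →₀ ℝ} (hf : 0 ≤ f)
    (hsrc : ∀ v ∉ H, 0 ≤ divergence f v) :
    ∃ g : V × V →₀ ℝ, 0 ≤ g ∧ g ≤ f ∧ (∀ e, e.1 ∈ H → g e = 0) ∧
      ∀ v ∉ H, divergence g v = divergence f v := by
  let outf : V → ℝ := fun v => ∑ e ∈ f.support.filter (fun e => e.1 = v), f e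
  let part : (V → Set.Icc (0 : ℝ) 1) → V → ℝ := fun θ v =>
    ∑ e ∈ f.support.filter (fun e => e.2 = v), θ e.1 * f e
  have hdiv : ∀ v, divergence f v =
      outf v - ∑ e ∈ f.support.filter (fun e => e.2 = v), f e := fun v => by
    rw [divergence_apply, Finsupp.sub_apply, mapDomain_apply_eq_sum_filter _ subset_rfl,
      mapDomain_apply_eq_sum_filter _ subset_rfl]
  have hout0 : ∀ v, 0 ≤ outf v := fun v => Finset.sum_nonneg fun e _ => hf e
  have hpart0 : ∀ θ v, 0 ≤ part θ v := fun θ v =>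
    Finset.sum_nonneg fun e _ => mul_nonneg (θ e.1).2.1 (hf e)
  have hpart_le : ∀ θ, ∀ v, part θ v + divergence f v ≤ outf v := fun θ v => by
    have : part θ v ≤ ∑ e ∈ f.support.filter (fun e => e.2 = v), f e :=
      Finset.sum_le_sum fun e _ => mul_le_of_le_one_left (hf e) (θ e.1).2.2
    rw [hdiv v]
    linarith
  let Φ : (V → Set.Icc (0 : ℝ) 1) →o (V → Set.Icc (0 : ℝ) 1) :=
    { toFun := fun θ v => if hv : v ∈ H then ⟨0, le_rfl, zero_le_one⟩ else
        ⟨(part θ v + divergence f v) / outf v,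
          div_nonneg (add_nonneg (hpart0 θ v) (hsrc v hv)) (hout0 v),
          div_le_one_of_le₀ (hpart_le θ v) (hout0 v)⟩
      monotone' := fun θ θ' hθ v => by
        by_cases hv : v ∈ H
        · simp [hv]
        · simp only [hv, dite_false]
          refine div_le_div_of_nonneg_right (add_le_add_left ?_ _) (hout0 v)
          exact Finset.sum_le_sum fun e _ => mul_le_mul_of_nonneg_right (hθ e.1) (hf e) }
  have : Fact ((0 : ℝ) ≤ 1) := ⟨zero_le_one⟩
  obtain ⟨θ, hθ⟩ : ∃ θ, Φ θ = θ := ⟨Φ.lfp, Φ.map_lfp⟩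
  have hθH : ∀ v ∈ H, (θ v : ℝ) = 0 := fun v hv => by
    rw [← hθ]
    change ((if hv : v ∈ H then _ else _ : Set.Icc (0 : ℝ) 1) : ℝ) = 0
    rw [dif_pos hv]
  have hθV : ∀ v ∉ H, (θ v : ℝ) * outf v = part θ v + divergence f v := fun v hv => by
    have h1 : (θ v : ℝ) = (part θ v + divergence f v) / outf v := by
      conv_lhs => rw [← hθ]
      change ((if hv : v ∈ H then _ else _ : Set.Icc (0 : ℝ) 1) : ℝ) = _
      rw [dif_neg hv]
    rcases (hout0 v).eq_or_lt with h0 | h0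
    · have h2 := hpart_le θ v
      have h3 := add_nonneg (hpart0 θ v) (hsrc v hv)
      rw [← h0] at h2 ⊢
      rw [mul_zero, le_antisymm h2 h3]
    · rw [h1, div_mul_cancel₀ _ h0.ne']
  let g : V × V →₀ ℝ := Finsupp.onFinset f.support (fun e => θ e.1 * f e)
    (fun e he => Finsupp.mem_support_iff.2 (right_ne_zero_of_mul he))
  have hg : ∀ e, g e = θ e.1 * f e := fun e => rfl
  have hgs : g.support ⊆ f.support := Finsupp.support_onFinset_subset
  refine ⟨g, fun e => mul_nonneg (θ e.1).2.1 (hf e),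
    fun e => mul_le_of_le_one_left (hf e) (θ e.1).2.2,
    fun e he => by rw [hg, hθH _ he, zero_mul], fun v hv => ?_⟩
  have h1 : ∑ e ∈ f.support.filter (fun e => e.1 = v), g e = θ v * outf v := by
    rw [Finset.mul_sum]
    exact Finset.sum_congr rfl fun e he => by rw [hg, (Finset.mem_filter.1 he).2]
  rw [divergence_apply, Finsupp.sub_apply, mapDomain_apply_eq_sum_filter _ hgs,
    mapDomain_apply_eq_sum_filter _ hgs, h1, hθV v hv]
  simp only [hg, part]
  ring

end FirstHitting

section HeightBound

variable {V : Type*} {α : ℝ}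

lemma linearCombination_eq_sum {ι : Type*} (ψ : ι → ℝ) (a : ι →₀ ℝ) :
    Finsupp.linearCombination ℝ ψ a = a.sum fun z t => t * ψ z := by
  simp [Finsupp.linearCombination_apply]

/-- A circulation-free flow carrying mass `M` to `P` from atoms at height `0` pays at least
`M ^ α` per unit of height. -/
lemma powCost_mul_height_le (hα0 : 0 ≤ α) (hα1 : α ≤ 1) {f : V × V →₀ ℝ} (hf : 0 ≤ f)
    (hcf : CirculationFree f) {c : V →₀ ℝ} (hc : 0 ≤ c) {M : ℝ} (hM : 0 < M) {P : V}
    (hdiv : divergence f = c - Finsupp.single P M) {u : V → ℝ} (hu : ∀ z ∈ c.support, u z = 0) :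
    powCost α M * u P ≤ flowCost α (fun e => |u e.1 - u e.2|) f := by
  have hle : ∀ e, f e ≤ M := fun e => hcf.apply_le (fun s => by
    rw [hdiv, map_sub, linearCombination_eq_sum, Finsupp.linearCombination_single, smul_eq_mul]
    have h1 : 0 ≤ c.sum fun z t => t * s.indicator (1 : V → ℝ) z :=
      Finset.sum_nonneg fun z _ =>
        mul_nonneg (hc z) (Set.indicator_nonneg (fun _ _ => zero_le_one) z)
    have h2 : s.indicator (1 : V → ℝ) P ≤ 1 :=
      Set.indicator_le_self' (fun _ _ => zero_le_one) P
    nlinarith) e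
  have h1 := linearCombination_divergence u f
  have h0 : (c.sum fun z t => t * u z) = 0 :=
    Finset.sum_eq_zero fun z hz => by simp only [hu z hz, mul_zero]
  rw [hdiv, map_sub, linearCombination_eq_sum, h0, Finsupp.linearCombination_single, smul_eq_mul,
    zero_sub] at h1
  have h2 : M * (powCost α M * u P) ≤ M * flowCost α (fun e => |u e.1 - u e.2|) f := by
    calc M * (powCost α M * u P) = powCost α M * -(f.sum fun e t => t * (u e.1 - u e.2)) := by
          rw [← h1]; ring
      _ = ∑ e ∈ f.support, f e * powCost α M * -(u e.1 - u e.2) := by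
          rw [Finsupp.sum, ← Finset.sum_neg_distrib, Finset.mul_sum]
          exact Finset.sum_congr rfl fun e _ => by ring
      _ ≤ ∑ e ∈ f.support, f e * powCost α M * |u e.1 - u e.2| :=
          Finset.sum_le_sum fun e _ => mul_le_mul_of_nonneg_left (neg_le_abs _)
            (mul_nonneg (hf e) (powCost_nonneg hM.le))
      _ ≤ ∑ e ∈ f.support, M * powCost α (f e) * |u e.1 - u e.2| :=
          Finset.sum_le_sum fun e _ => mul_le_mul_of_nonneg_right
            (mul_powCost_le hα0 hα1 (hf e) (hle e)) (abs_nonneg _)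
      _ = M * flowCost α (fun e => |u e.1 - u e.2|) f := by
          rw [flowCost, Finsupp.sum, Finset.mul_sum]
          exact Finset.sum_congr rfl fun e _ => by ring
  exact le_of_mul_le_mul_left h2 hM

end HeightBound

section DyadicGathering

variable {α : ℝ} {d : ℕ}

lemma massOf_eq_linearCombination {m : ℕ} (a : Pt m →₀ ℝ) :
    massOf a = Finsupp.linearCombination ℝ (fun _ => (1 : ℝ)) a := by
  simp [massOf, Finsupp.linearCombination_apply]

lemma massOf_sum {m : ℕ} {κ : Type*} (s : Finset κ) (a : κ → Pt m →₀ ℝ) :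
    massOf (∑ k ∈ s, a k) = ∑ k ∈ s, massOf (a k) := by
  simp only [massOf_eq_linearCombination, map_sum]

lemma massOf_nonneg {m : ℕ} {a : Pt m →₀ ℝ} (ha : 0 ≤ a) : 0 ≤ massOf a :=
  Finset.sum_nonneg fun z _ => ha z

lemma massOf_mapDomain {m m' : ℕ} (T : Pt m → Pt m') (a : Pt m →₀ ℝ) :
    massOf (a.mapDomain T) = massOf a := by
  simp only [massOf_eq_linearCombination, Finsupp.linearCombination_mapDomain]
  rfl

lemma dist_le_of_forall_abs_sub_le {x z : Pt d} {r : ℝ} (hr : 0 ≤ r)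
    (h : ∀ i, |z i - x i| ≤ r) : dist z x ≤ r * Real.sqrt d := by
  rw [EuclideanSpace.dist_eq, ← Real.sqrt_sq hr, ← Real.sqrt_mul (sq_nonneg r)]
  refine Real.sqrt_le_sqrt ?_
  calc ∑ i, dist (z i) (x i) ^ 2 ≤ ∑ _i : Fin d, r ^ 2 :=
        Finset.sum_le_sum fun i _ => by
          rw [Real.dist_eq]
          exact pow_le_pow_left₀ (abs_nonneg _) (h i) 2
    _ = r ^ 2 * d := by simp [mul_comm]

/-- Every atomic measure with at most `n` atoms in a cube of half-side `r` can be gathered at the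
centre of the cube with cost at most `B * M ^ α * r`, where `M` is its mass. -/
def CubeGatherBound (α : ℝ) (d n : ℕ) (B : ℝ) : Prop :=
  ∀ a : Pt d →₀ ℝ, 0 ≤ a → a.support.card ≤ n → ∀ (x : Pt d) (r : ℝ), 0 ≤ r →
    (∀ z ∈ a.support, ∀ i, |z i - x i| ≤ r) →
    ∃ f : Pt d × Pt d →₀ ℝ, 0 ≤ f ∧ divergence f = a - Finsupp.single x (massOf a) ∧
      flowCost α edgeLength f ≤ B * powCost α (massOf a) * r

lemma mapDomain_const {m : ℕ} (a : Pt m →₀ ℝ) {κ : Type*} (x : κ) :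
    a.mapDomain (fun _ => x) = Finsupp.single x (massOf a) := by
  rw [Finsupp.mapDomain, massOf, Finsupp.sum, Finsupp.sum, Finsupp.single_finsetSum]

lemma divergence_star {m : ℕ} (a : Pt m →₀ ℝ) (x : Pt m) :
    divergence (a.mapDomain fun z => (z, x)) = a - Finsupp.single x (massOf a) := by
  rw [divergence_apply, ← Finsupp.mapDomain_comp, ← Finsupp.mapDomain_comp, ← mapDomain_const a x]
  congr 1
  exact Finsupp.mapDomain_id

lemma cubeGatherBound_star (hα0 : 0 ≤ α) (hα1 : α ≤ 1) (d n : ℕ) :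
    CubeGatherBound α d n (n * Real.sqrt d) := by
  intro a ha hn x r hr hx
  refine ⟨a.mapDomain fun z => (z, x), Finsupp.mapDomain_nonneg ha, divergence_star a x, ?_⟩
  · refine (flowCost_mapDomain_le hα0 hα1 edgeLength_nonneg _ ha).trans ?_
    have hM := powCost_nonneg (α := α) (massOf_nonneg ha)
    have hle : ∀ z ∈ a.support, powCost α (a z) * edgeLength (z, x) ≤
        powCost α (massOf a) * (r * Real.sqrt d) := fun z hz =>
      mul_le_mul (powCost_mono hα0 (ha z)
        (Finset.single_le_sum (f := fun z => a z) (fun z _ => ha z) hz))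
        (dist_le_of_forall_abs_sub_le hr (hx z hz)) (edgeLength_nonneg _) hM
    refine (Finset.sum_le_card_nsmul _ _ _ hle).trans ?_
    rw [nsmul_eq_mul]
    calc (a.support.card : ℝ) * (powCost α (massOf a) * (r * Real.sqrt d))
        ≤ n * (powCost α (massOf a) * (r * Real.sqrt d)) := by gcongr
      _ = _ := by ring

lemma CubeGatherBound.step (hα0 : 0 ≤ α) (hα1 : α ≤ 1) {n : ℕ} {B : ℝ} (hB : 0 ≤ B)
    (h : CubeGatherBound α d n B) :
    CubeGatherBound α d n ((2 : ℝ) ^ (d * (1 - α) - 1) * (B + Real.sqrt d)) := by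
  intro a ha hn x r hr hx
  let side : Pt d → Fin d → Bool := fun z i => decide (x i ≤ z i)
  let ctr : (Fin d → Bool) → Pt d := fun s =>
    WithLp.toLp 2 fun i => x i + if s i then r / 2 else -(r / 2)
  let part : (Fin d → Bool) → Pt d →₀ ℝ := fun s => a.filter fun z => side z = s
  have hpart : ∑ s, part s = a := by
    ext z
    simp [part, Finsupp.finsetSum_apply, Finsupp.filter_apply]
  have hpart0 : ∀ s, 0 ≤ part s := fun s z => by
    simp only [part, Finsupp.filter_apply, Finsupp.zero_apply]
    split_ifs
    exacts [ha z, le_rfl]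
  have hr2 : 0 ≤ r / 2 := by positivity
  have hctr : ∀ s i, |ctr s i - x i| ≤ r / 2 := fun s i => by
    simp only [ctr, add_sub_cancel_left]
    split_ifs
    · rw [abs_of_nonneg hr2]
    · rw [abs_neg, abs_of_nonneg hr2]
  have hcube : ∀ s, ∀ z ∈ (part s).support, ∀ i, |z i - ctr s i| ≤ r / 2 := by
    intro s z hz i
    simp only [part, Finsupp.support_filter, Finset.mem_filter] at hz
    have h1 := abs_le.1 (hx z hz.1 i)
    rw [← hz.2]
    by_cases hi : x i ≤ z i
    · simp only [ctr, side, hi, decide_true, if_true]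
      exact abs_le.2 ⟨by linarith, by linarith⟩
    · simp only [ctr, side, hi, decide_false]
      exact abs_le.2 ⟨by simp; linarith, by simp; linarith⟩
  have hcard : ∀ s, (part s).support.card ≤ n := fun s =>
    (Finset.card_le_card (by simp [part, Finsupp.support_filter])).trans hn
  choose f hf0 hfd hfc using fun s => h (part s) (hpart0 s) (hcard s) (ctr s) (r / 2) hr2 (hcube s)
  have hM0 : ∀ s, 0 ≤ massOf (part s) := fun s => massOf_nonneg (hpart0 s)
  have hM : ∑ s, massOf (part s) = massOf a := by rw [← massOf_sum, hpart]
  have he0 : ∀ s, 0 ≤ Finsupp.single (ctr s, x) (massOf (part s)) := fun s =>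
    Finsupp.single_nonneg.2 (hM0 s)
  refine ⟨∑ s, (f s + Finsupp.single (ctr s, x) (massOf (part s))),
    Finset.sum_nonneg fun s _ => add_nonneg (hf0 s) (he0 s), ?_, ?_⟩
  · simp only [map_sum, map_add, hfd, divergence_single, sub_add_sub_cancel,
      Finset.sum_sub_distrib, hpart, ← Finsupp.single_finsetSum, hM]
  · have hcost : ∀ s, flowCost α edgeLength (f s + Finsupp.single (ctr s, x) (massOf (part s))) ≤
        (B + Real.sqrt d) * (r / 2) * powCost α (massOf (part s)) := fun s => by
      refine (flowCost_add_le hα0 hα1 edgeLength_nonneg (hf0 s) (he0 s)).trans ?_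
      rw [flowCost_single]
      have h1 := mul_le_mul_of_nonneg_left (dist_le_of_forall_abs_sub_le hr2 (hctr s))
        (powCost_nonneg (α := α) (hM0 s))
      have h2 := hfc s
      simp only [edgeLength] at h1 ⊢
      linarith
    refine (flowCost_sum_le hα0 hα1 edgeLength_nonneg _
      fun s _ => add_nonneg (hf0 s) (he0 s)).trans ((Finset.sum_le_sum fun s _ => hcost s).trans ?_)
    rw [← Finset.mul_sum]
    have hJ := sum_powCost_le hα0 hα1 hM0
    rw [hM] at hJ
    have hN : ((Fintype.card (Fin d → Bool) : ℕ) : ℝ) ^ (1 - α) = 2 ^ (d * (1 - α) - 1) * 2 := by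
      rw [Fintype.card_fun, Fintype.card_bool, Fintype.card_fin, Nat.cast_pow, Nat.cast_ofNat,
        ← Real.rpow_natCast, ← Real.rpow_mul zero_le_two, Real.rpow_sub_one two_ne_zero,
        div_mul_cancel₀ _ (two_ne_zero)]
    rw [hN] at hJ
    calc _ ≤ (B + Real.sqrt d) * (r / 2) *
          ((2 : ℝ) ^ (d * (1 - α) - 1) * 2 * powCost α (massOf a)) :=
          mul_le_mul_of_nonneg_left hJ (by positivity)
      _ = _ := by ring

/-- Iterating the dyadic subdivision brings the gathering constant arbitrarily close to
`√d / (2 ^ (1 - d (1 - α)) - 1)`. -/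
lemma cubeGatherBound_of_pos (hα0 : 0 ≤ α) (hα1 : α ≤ 1) (hd : (d : ℝ) * (1 - α) < 1) (n : ℕ)
    {ε : ℝ} (hε : 0 < ε) :
    CubeGatherBound α d n (Real.sqrt d / ((2 : ℝ) ^ (1 - d * (1 - α)) - 1) + ε) := by
  set q : ℝ := (2 : ℝ) ^ (d * (1 - α) - 1) with hq
  set Binf : ℝ := Real.sqrt d / ((2 : ℝ) ^ (1 - d * (1 - α)) - 1) with hBinf
  have hq0 : 0 < q := Real.rpow_pos_of_pos two_pos _
  have hq1 : q < 1 := Real.rpow_lt_one_of_one_lt_of_neg one_lt_two (by linarith)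
  have hqinv : (2 : ℝ) ^ (1 - d * (1 - α)) = q⁻¹ := by
    rw [hq, ← Real.rpow_neg zero_le_two, neg_sub]
  have hgt : 1 < q⁻¹ := (one_lt_inv₀ hq0).2 hq1
  have hB0 : 0 ≤ Binf := by
    rw [hBinf, hqinv]
    exact div_nonneg (Real.sqrt_nonneg _) (by linarith)
  have hfix : q * (Binf + Real.sqrt d) = Binf := by
    rw [hBinf, hqinv]
    have : q⁻¹ - 1 ≠ 0 := by linarith
    have h1q : 1 - q ≠ 0 := by linarith
    field_simp
    ring
  set D : ℝ := n * Real.sqrt d with hD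
  have hD0 : 0 ≤ D := by positivity
  have hiter : ∀ k : ℕ, CubeGatherBound α d n (Binf + q ^ k * (D - Binf)) := by
    intro k
    induction k with
    | zero => simpa using cubeGatherBound_star hα0 hα1 d n
    | succ k ih =>
      have hk0 : 0 ≤ q ^ k := pow_nonneg hq0.le k
      have hk1 : q ^ k ≤ 1 := pow_le_one₀ hq0.le hq1.le
      have h := ih.step hα0 hα1 (by nlinarith)
      convert h using 1
      rw [← hq]
      linear_combination -hfix
  obtain ⟨k, hk⟩ := exists_pow_lt_of_lt_one (show 0 < ε / (|D - Binf| + 1) by positivity) hq1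
  rw [lt_div_iff₀ (by positivity)] at hk
  intro a ha hn x r hr hx
  obtain ⟨f, hf0, hfd, hfc⟩ := hiter k a ha hn x r hr hx
  refine ⟨f, hf0, hfd, hfc.trans ?_⟩
  refine mul_le_mul_of_nonneg_right (mul_le_mul_of_nonneg_right ?_
    (powCost_nonneg (massOf_nonneg ha))) hr
  have h1 : q ^ k * (D - Binf) ≤ q ^ k * |D - Binf| :=
    mul_le_mul_of_nonneg_left (le_abs_self _) (pow_nonneg hq0.le k)
  have h2 : 0 < q ^ k := pow_pos hq0 k
  linarith

end DyadicGathering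

section Slicing

variable {m : ℕ} {α : ℝ} {p v : Pt m}

lemma abs_proj_sub_le (hv : ‖v‖ = 1) (x y : Pt m) : |proj p v x - proj p v y| ≤ dist x y := by
  have h : proj p v x - proj p v y = ⟪x - y, v⟫ := by
    rw [proj, proj, ← inner_sub_left, sub_sub_sub_cancel_right]
  rw [h, dist_eq_norm]
  simpa [hv] using abs_real_inner_le_norm (x - y) v

lemma proj_add_smul (x y : Pt m) (s : ℝ) :
    proj p v (x + s • (y - x)) = proj p v x + s * (proj p v y - proj p v x) := by
  simp only [proj, inner_sub_left, inner_add_left, real_inner_smul_left]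
  ring

lemma proj_axis (hv : ‖v‖ = 1) (t : ℝ) : proj p v (p + t • v) = t := by
  simp [proj, real_inner_smul_left, hv]

/-- Clipping segments at the hyperplane `proj p v = t`: `ρ x y` is the start of the part of the
segment from `x` to `y` below the hyperplane. -/
lemma exists_clip (hv : ‖v‖ = 1) (t : ℝ) :
    ∃ ρ : Pt m → Pt m → Pt m, (∀ x y, proj p v x ≤ t → ρ x y = x) ∧
      (∀ x y, t < proj p v x → proj p v (ρ x y) = t) ∧
      ∀ x y, dist (ρ x y) (ρ y x) + |max (proj p v x) t - max (proj p v y) t| ≤ dist x y := by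
  let ρ : Pt m → Pt m → Pt m := fun x y =>
    if proj p v x ≤ t then x else
      if proj p v y ≤ t then x + ((proj p v x - t) / (proj p v x - proj p v y)) • (y - x)
      else p + t • v
  have hlow : ∀ x y, proj p v x ≤ t → ρ x y = x := fun x y h => if_pos h
  have hmid : ∀ x y, t < proj p v x → proj p v y ≤ t →
      ρ x y = x + ((proj p v x - t) / (proj p v x - proj p v y)) • (y - x) := fun x y h h' => by
    simp only [ρ, if_neg h.not_ge, if_pos h']
  have hup : ∀ x y, t < proj p v x → t < proj p v y → ρ x y = p + t • v := fun x y h h' => by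
    simp only [ρ, if_neg h.not_ge, if_neg h'.not_ge]
  have hcross : ∀ x y, t < proj p v x → proj p v y ≤ t →
      dist (ρ x y) (ρ y x) + |max (proj p v x) t - max (proj p v y) t| ≤ dist x y := by
    intro x y hx hy
    have hpos : 0 < proj p v x - proj p v y := by linarith
    rw [hlow y x hy, hmid x y hx hy, max_eq_left hx.le, max_eq_right hy,
      abs_of_pos (sub_pos.2 hx)]
    set s := (proj p v x - t) / (proj p v x - proj p v y) with hs
    have hs0 : 0 ≤ s := div_nonneg (by linarith) hpos.le
    have hs1 : s ≤ 1 := (div_le_one hpos).2 (by linarith)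
    have h1 : x + s • (y - x) - y = (1 - s) • (x - y) := by module
    have h2 : proj p v x - t = s * (proj p v x - proj p v y) := by
      rw [hs, div_mul_cancel₀ _ hpos.ne']
    rw [dist_eq_norm, h1, norm_smul, Real.norm_of_nonneg (by linarith), ← dist_eq_norm, h2]
    nlinarith [mul_le_mul_of_nonneg_left ((le_abs_self _).trans (abs_proj_sub_le (p := p) hv x y))
      hs0]
  refine ⟨ρ, hlow, fun x y hx => ?_, fun x y => ?_⟩
  · rcases le_or_gt (proj p v y) t with hy | hy
    · have hpos : proj p v x - proj p v y ≠ 0 := by linarith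
      rw [hmid x y hx hy, proj_add_smul]
      field_simp
      ring
    · rw [hup x y hx hy, proj_axis hv]
  · rcases le_or_gt (proj p v x) t with hx | hx <;> rcases le_or_gt (proj p v y) t with hy | hy
    · rw [hlow x y hx, hlow y x hy, max_eq_right hx, max_eq_right hy, sub_self, abs_zero, add_zero]
    · rw [dist_comm, abs_sub_comm, dist_comm x]
      exact hcross y x hy hx
    · exact hcross x y hx hy
    · rw [hup x y hx hy, hup y x hy hx, dist_self, zero_add, max_eq_left hx.le, max_eq_left hy.le]
      exact abs_proj_sub_le hv x y

/-- The part of a flow from `c` to `P` below a separating hyperplane contains a flow from `c` to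
an atomic measure on the hyperplane, and the rest of the flow pays at least `M ^ α` per unit of
height. -/
lemma exists_flow_to_hyperplane (hv : ‖v‖ = 1) (hα0 : 0 ≤ α) (hα1 : α ≤ 1)
    {f : Pt m × Pt m →₀ ℝ} (hf : 0 ≤ f) (hcf : CirculationFree f) {c : Pt m →₀ ℝ} (hc : 0 ≤ c)
    (hM : 0 < massOf c) {P : Pt m} (hdiv : divergence f = c - Finsupp.single P (massOf c)) {t : ℝ}
    (htP : t ≤ proj p v P) (htc : ∀ z ∈ c.support, proj p v z ≤ t) :
    ∃ (g : Pt m × Pt m →₀ ℝ) (a : Pt m →₀ ℝ), 0 ≤ g ∧ 0 ≤ a ∧ divergence g = c - a ∧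
      (∀ z ∈ a.support, proj p v z = t) ∧
      flowCost α edgeLength g + powCost α (massOf c) * (proj p v P - t) ≤
        flowCost α edgeLength f := by
  obtain ⟨ρ, hlow, hup, hlen⟩ := exists_clip (p := p) hv t
  let F : Pt m × Pt m → Pt m × Pt m := fun e => (ρ e.1 e.2, ρ e.2 e.1)
  have hF0 : 0 ≤ f.mapDomain F := Finsupp.mapDomain_nonneg hf
  have hFd : ∀ w, proj p v w ≠ t → divergence (f.mapDomain F) w = c w := by
    intro w hw
    rw [divergence_apply, ← Finsupp.mapDomain_comp, ← Finsupp.mapDomain_comp, Finsupp.sub_apply,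
      mapDomain_apply_eq_sum_filter _ subset_rfl, mapDomain_apply_eq_sum_filter _ subset_rfl]
    simp only [Function.comp_apply, F]
    rcases hw.lt_or_gt with hw | hw
    · have hρ : ∀ x y, ρ x y = w ↔ x = w := by
        intro x y
        rcases le_or_gt (proj p v x) t with hx | hx
        · rw [hlow x y hx]
        · refine ⟨fun h => ?_, fun h => ?_⟩
          · have := hup x y hx
            rw [h] at this
            linarith
          · rw [h] at hx
            linarith
      have hPw : P ≠ w := by
        rintro rfl
        linarith
      have h1 := DFunLike.congr_fun hdiv w
      rw [divergence_apply, Finsupp.sub_apply, mapDomain_apply_eq_sum_filter _ subset_rfl,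
        mapDomain_apply_eq_sum_filter _ subset_rfl, Finsupp.sub_apply,
        Finsupp.single_eq_of_ne hPw.symm, sub_zero] at h1
      simp only [hρ]
      convert h1
    · have hρ : ∀ x y, ρ x y ≠ w := by
        rintro x y rfl
        rcases le_or_gt (proj p v x) t with hx | hx
        · rw [hlow x y hx] at hw
          linarith
        · rw [hup x y hx] at hw
          exact lt_irrefl _ hw
      have hcw : c w = 0 := by
        by_contra h
        linarith [htc w (Finsupp.mem_support_iff.2 h)]
      simp [hρ, hcw]
  obtain ⟨g, hg0, hgle, hgH, hgd⟩ := exists_subflow_stopped {z | proj p v z = t} hF0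
    fun w hw => by rw [hFd w hw]; exact hc w
  have hda : ∀ w, proj p v w ≠ t → (c - divergence g) w = 0 := fun w hw => by
    rw [Finsupp.sub_apply, hgd w hw, hFd w hw, sub_self]
  refine ⟨g, c - divergence g, hg0, fun w => ?_, by abel, fun w hw => ?_, ?_⟩
  · by_cases hw : proj p v w = t
    · have h1 : g.mapDomain Prod.fst w = 0 := by
        rw [mapDomain_apply_eq_sum_filter _ subset_rfl]
        refine Finset.sum_eq_zero fun e he => hgH e ?_
        simp only [Finset.mem_filter] at he
        rw [he.2]
        exact hw
      have h2 : 0 ≤ g.mapDomain Prod.snd w := Finsupp.mapDomain_nonneg (f := Prod.snd) hg0 w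
      have h3 := hc w
      rw [Finsupp.zero_apply] at h3 ⊢
      rw [Finsupp.sub_apply, divergence_apply, Finsupp.sub_apply, h1]
      linarith
    · rw [hda w hw]
      exact le_rfl
  · by_contra h
    exact Finsupp.mem_support_iff.1 hw (hda w h)
  · have h1 := (flowCost_mono hα0 edgeLength_nonneg hg0 hgle).trans
      (flowCost_mapDomain_le hα0 hα1 edgeLength_nonneg F hf)
    have h2 := powCost_mul_height_le hα0 hα1 hf hcf hc hM hdiv
      (u := fun z => max (proj p v z) t - t) (fun z hz => by simp [htc z hz])
    simp only [max_eq_left htP, sub_sub_sub_cancel_right] at h2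
    refine (add_le_add h1 h2).trans ?_
    rw [flowCost, flowCost, flowCost, Finsupp.sum, Finsupp.sum, Finsupp.sum,
      ← Finset.sum_add_distrib]
    refine Finset.sum_le_sum fun e _ => ?_
    rw [← mul_add]
    exact mul_le_mul_of_nonneg_left (hlen e.1 e.2) (powCost_nonneg (hf e))

end Slicing

section Cylinder

variable {d : ℕ} {α : ℝ} {p v : Pt (d + 1)}

lemma exists_orthogonal_coordinates (hv : ‖v‖ = 1) :
    ∃ j : Pt d →ₗᵢ[ℝ] Pt (d + 1), (∀ w, ⟪j w, v⟫ = 0) ∧ ∀ z, ⟪z, v⟫ = 0 → ∃ w, j w = z := by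
  have hv0 : v ≠ 0 := by
    rintro rfl
    simp at hv
  have : Fact (Module.finrank ℝ (Pt (d + 1)) = d + 1) := ⟨by simp⟩
  let b := OrthonormalBasis.fromOrthogonalSpanSingleton (𝕜 := ℝ) d hv0
  refine ⟨(ℝ ∙ v)ᗮ.subtypeₗᵢ.comp b.repr.symm.toLinearIsometry, fun w => ?_, fun z hz => ?_⟩
  · exact Submodule.mem_orthogonal_singleton_iff_inner_left.1 (b.repr.symm w).2
  · exact ⟨b.repr ⟨z, Submodule.mem_orthogonal_singleton_iff_inner_left.2 hz⟩, by simp⟩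

lemma norm_smul_add_sq (hv : ‖v‖ = 1) {j : Pt d →ₗᵢ[ℝ] Pt (d + 1)} (hj : ∀ w, ⟪j w, v⟫ = 0)
    (s : ℝ) (w : Pt d) : ‖s • v + j w‖ ^ 2 = s ^ 2 + ‖w‖ ^ 2 := by
  have h := norm_add_sq_eq_norm_sq_add_norm_sq_real (x := s • v) (y := j w)
    (by rw [real_inner_smul_left, real_inner_comm, hj, mul_zero])
  rw [sq, h, norm_smul, hv, j.norm_map, mul_one, Real.norm_eq_abs, abs_mul_abs_self]
  ring

/-- An atomic measure on the hyperplane `proj p v = t` which receives a flow from a measure inside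
the cylinder of radius `R` can be replaced by a flow to the axis point of the hyperplane. -/
lemma exists_flow_to_axis (hv : ‖v‖ = 1) (hα0 : 0 ≤ α) (hα1 : α ≤ 1)
    (hd : (d : ℝ) * (1 - α) < 1) {R : ℝ} (hR : 0 ≤ R) {c a : Pt (d + 1) →₀ ℝ} (ha : 0 ≤ a)
    (hcR : ∀ z ∈ c.support, ‖z - p - proj p v z • v‖ ≤ R) {t : ℝ}
    (hat : ∀ z ∈ a.support, proj p v z = t) {g : Pt (d + 1) × Pt (d + 1) →₀ ℝ} (hg : 0 ≤ g)
    (hdiv : divergence g = c - a) {ε : ℝ} (hε : 0 < ε) :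
    ∃ f : Pt (d + 1) × Pt (d + 1) →₀ ℝ, 0 ≤ f ∧
      divergence f = c - Finsupp.single (p + t • v) (massOf c) ∧
      flowCost α edgeLength f ≤ flowCost α edgeLength g +
        (Real.sqrt d / ((2 : ℝ) ^ (1 - d * (1 - α)) - 1) + ε) * powCost α (massOf c) * R := by
  obtain ⟨j, hj, hjs⟩ := exists_orthogonal_coordinates hv
  have horth : ∀ z, ⟪z - p - proj p v z • v, v⟫ = 0 := fun z => by
    rw [inner_sub_left, real_inner_smul_left, real_inner_self_eq_norm_sq, hv, proj]
    ring
  choose k hk using fun z => hjs _ (horth z)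
  obtain ⟨r, hrK, hrid, hrc⟩ := exists_convex_retraction (K := Metric.closedBall (0 : Pt d) R)
    ⟨0, Metric.mem_closedBall_self hR⟩ Metric.isClosed_closedBall.isComplete
    (convex_closedBall 0 R)
  let T : Pt (d + 1) → Pt (d + 1) := fun z => p + proj p v z • v + j (r (k z))
  let J : Pt d → Pt (d + 1) := fun w => p + t • v + j w
  have hT : ∀ z w, dist (T z) (T w) ≤ dist z w := by
    intro z w
    have h1 : T z - T w = (proj p v z - proj p v w) • v + j (r (k z) - r (k w)) := by
      simp only [T, map_sub]
      module
    have h2 : z - w = (proj p v z - proj p v w) • v + j (k z - k w) := by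
      rw [map_sub, hk, hk]
      module
    rw [dist_eq_norm, dist_eq_norm]
    refine le_of_sq_le_sq ?_ (norm_nonneg _)
    rw [h1, h2, norm_smul_add_sq hv hj, norm_smul_add_sq hv hj, ← dist_eq_norm, ← dist_eq_norm]
    have := pow_le_pow_left₀ dist_nonneg (hrc (k z) (k w)) 2
    linarith
  have hJ : ∀ z w, dist (J z) (J w) ≤ dist z w := fun z w => by
    simp only [J, dist_add_left, j.dist_map, le_refl]
  have hTc : c.mapDomain T = c := mapDomain_eq_self fun z hz => by
    have h1 : k z ∈ Metric.closedBall (0 : Pt d) R := by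
      rw [mem_closedBall_zero_iff, ← j.norm_map, hk]
      exact hcR z hz
    simp only [T, hrid _ h1, hk]
    module
  set a' : Pt d →₀ ℝ := a.mapDomain fun z => r (k z) with ha'
  have ha'0 : 0 ≤ a' := Finsupp.mapDomain_nonneg ha
  have hTa : a.mapDomain T = a'.mapDomain J := by
    rw [ha', ← Finsupp.mapDomain_comp]
    exact Finsupp.mapDomain_congr fun z hz => by simp only [T, J, Function.comp_apply, hat z hz]
  have hmass : massOf a' = massOf c := by
    rw [ha', massOf_mapDomain]
    have h1 := massOf_divergence g
    rw [hdiv, massOf_eq_linearCombination, map_sub, ← massOf_eq_linearCombination,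
      ← massOf_eq_linearCombination] at h1
    linarith
  obtain ⟨f, hf0, hfd, hfc⟩ := cubeGatherBound_of_pos hα0 hα1 hd a'.support.card hε a' ha'0 le_rfl
    0 R hR (fun z hz i => by
      obtain ⟨y, -, rfl⟩ := Finset.mem_image.1 (Finsupp.mapDomain_support hz)
      have h1 := mem_closedBall_zero_iff.1 (hrK (k y))
      have h2 := PiLp.norm_apply_le (r (k y)) i
      simpa using h2.trans h1)
  rw [hmass] at hfd hfc
  have hg'0 : 0 ≤ g.mapDomain (Prod.map T T) := Finsupp.mapDomain_nonneg hg
  have hf'0 : 0 ≤ f.mapDomain (Prod.map J J) := Finsupp.mapDomain_nonneg hf0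
  refine ⟨g.mapDomain (Prod.map T T) + f.mapDomain (Prod.map J J), add_nonneg hg'0 hf'0, ?_, ?_⟩
  · have hJ0 : J 0 = p + t • v := by simp [J]
    rw [map_add, divergence_mapDomain, divergence_mapDomain, hdiv, hfd, Finsupp.mapDomain_sub,
      Finsupp.mapDomain_sub, hTc, hTa, Finsupp.mapDomain_single, hJ0]
    abel
  · exact (flowCost_add_le hα0 hα1 edgeLength_nonneg hg'0 hf'0).trans (add_le_add
      (flowCost_mapDomain_le_of_contracting hα0 hα1 hT hg)
      ((flowCost_mapDomain_le_of_contracting hα0 hα1 hJ hf0).trans hfc))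

end Cylinder

lemma massOf_pos {m : ℕ} {c : Pt m →₀ ℝ} (hc : 0 ≤ c) (hc0 : c ≠ 0) : 0 < massOf c := by
  refine lt_of_le_of_ne (massOf_nonneg hc) fun h => hc0 ?_
  have h1 := (Finset.sum_eq_zero_iff_of_nonneg fun z _ => hc z).1 h.symm
  exact Finsupp.support_eq_empty.1 (Finset.eq_empty_of_forall_notMem fun z hz =>
    Finsupp.mem_support_iff.1 hz (h1 z hz))

/-- The comparison of `dCost` towards `P` and `Q` when `P` lies above all atoms of `c`. -/
lemma dCost_sub_dCost_ge {m : ℕ} {X : Set (Pt m)} (hXc : IsCompact X) (hXconv : Convex ℝ X)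
    {α : ℝ} (hα0 : 0 ≤ α) (hα1 : α ≤ 1) {p v : Pt m} (hv : ‖v‖ = 1)
    (hmα : ((m : ℝ) - 1) * (1 - α) < 1) {c : Pt m →₀ ℝ} (hc : AtomicOn X c) (hc0 : c ≠ 0)
    {P Q : Pt m} (hP : P ∈ X) (hQ : Q ∈ X) {t : ℝ} (htP : t ≤ proj p v P)
    (htc : ∀ z ∈ c.support, proj p v z ≤ t) {R : ℝ}
    (hcR : ∀ z ∈ c.support, ‖z - p - proj p v z • v‖ ≤ R)
    (hQR : ‖Q - p - proj p v Q • v‖ ≤ R) :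
    massOf c ^ α * (proj p v P - t - Cconst m α * R - |proj p v Q - t|) ≤
      dCost X α c (Finsupp.single P (massOf c)) - dCost X α c (Finsupp.single Q (massOf c)) := by
  cases m with
  | zero => simp [Subsingleton.elim v 0] at hv
  | succ d =>
  have hcpos : 0 ≤ c := hc.1
  have hM := massOf_pos hcpos hc0
  have hR : 0 ≤ R := (norm_nonneg _).trans hQR
  have hd : (d : ℝ) * (1 - α) < 1 := by simpa using hmα
  have hsub : ∀ y ∈ X, ↑(Finsupp.single y (massOf c)).support ⊆ X := fun y hy z hz => by
    rw [Finset.mem_singleton.1 (Finsupp.support_single_subset hz)]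
    exact hy
  have hC : Cconst (d + 1) α =
      Real.sqrt d / ((2 : ℝ) ^ (1 - d * (1 - α)) - 1) + 1 := by simp [Cconst]
  rw [← powCost_of_ne_zero hM.ne', hC]
  set M := massOf c with hMdef
  set B := Real.sqrt d / ((2 : ℝ) ^ (1 - d * (1 - α)) - 1) with hB
  rw [le_sub_iff_add_le]
  obtain ⟨G₀, hG₀, -⟩ := exists_transportPath_of_convex hXc hXconv ⟨P, hP⟩ hα0 hα1 hc.2
    (hsub P hP) (Finsupp.mapDomain_nonneg hcpos) (divergence_star c P)
  refine le_csInf ⟨_, G₀, hG₀, rfl⟩ ?_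
  rintro _ ⟨G, hG, rfl⟩
  obtain ⟨f₀, hf₀, hf₀d, hf₀c⟩ := hG.exists_flow (α := α)
  obtain ⟨f, hf, -, hfd, hfc, hcf⟩ := exists_circulationFree hα0 hα1 edgeLength_nonneg hf₀
  obtain ⟨g, a, hg, ha, hgd, hat, hgc⟩ := exists_flow_to_hyperplane hv hα0 hα1 hf hcf hcpos hM
    (hfd.trans hf₀d) htP htc
  have hφ := powCost_nonneg (α := α) hM.le
  have hQdist : dist (p + t • v) Q ≤ |proj p v Q - t| + R := by
    have h1 : Q - (p + t • v) = (proj p v Q - t) • v + (Q - p - proj p v Q • v) := by module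
    rw [dist_comm, dist_eq_norm, h1]
    refine (norm_add_le _ _).trans (add_le_add (le_of_eq ?_) hQR)
    rw [norm_smul, hv, mul_one, Real.norm_eq_abs]
  have hbound : ∀ ε > 0, dCost X α c (Finsupp.single Q M) ≤
      G.cost α - powCost α M * (proj p v P - t) + (B + ε) * powCost α M * R +
        powCost α M * (|proj p v Q - t| + R) := by
    intro ε hε
    obtain ⟨h, hh, hhd, hhc⟩ := exists_flow_to_axis hv hα0 hα1 hd hR ha hcR hat hg hgd hε
    have he : 0 ≤ Finsupp.single (p + t • v, Q) M := Finsupp.single_nonneg.2 hM.le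
    refine (dCost_le_flowCost hXc hXconv ⟨P, hP⟩ hα0 hα1 hc.2 (hsub Q hQ) (add_nonneg hh he)
      (by rw [map_add, hhd, divergence_single]; abel)).trans ?_
    refine (flowCost_add_le hα0 hα1 edgeLength_nonneg hh he).trans ?_
    rw [flowCost_single]
    have h1 := mul_le_mul_of_nonneg_left hQdist hφ
    simp only [edgeLength] at h1 hhc hgc hfc hf₀c ⊢
    linarith
  refine le_of_forall_pos_le_add fun ε hε => ?_
  have hpos : 0 < powCost α M * R + 1 := by positivity
  have h1 := hbound (ε / (powCost α M * R + 1)) (div_pos hε hpos)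
  have h2 : ε / (powCost α M * R + 1) * (powCost α M * R) ≤ ε := by
    rw [div_mul_eq_mul_div, div_le_iff₀ hpos]
    nlinarith
  linarith

lemma proj_neg {m : ℕ} (p v z : Pt m) : proj p (-v) z = -proj p v z := inner_neg_right _ _

/-- Projectional comparison lemma: if `π(P) ≥ t₁ ≥ max π(z_j)`
or `π(P) ≤ t₁ ≤ min π(z_j)`, then
`d_α(c, m(c) δ_P) − d_α(c, m(c) δ_Q) ≥ m(c)^α (|π(P) − t₁| − C·R − |π(Q) − t₁|)`,
where `R` is the max of `‖z − p − π(z) v‖` over the atoms of `c` and `P, Q`. -/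
theorem stmt_14 {m : ℕ} (X : Set (Pt m)) (hXc : IsCompact X) (hXconv : Convex ℝ X)
    (α : ℝ) (hα0 : 0 ≤ α) (hα1 : α < 1)
    (p v : Pt m) (hv : ‖v‖ = 1) (hmα : ((m : ℝ) - 1) * (1 - α) < 1)
    (c : Pt m →₀ ℝ) (hc : AtomicOn X c) (hc0 : c ≠ 0)
    (P Q : Pt m) (hP : P ∈ X) (hQ : Q ∈ X)
    (t₁ : ℝ)
    (ht : (t₁ ≤ proj p v P ∧ ∀ z ∈ c.support, proj p v z ≤ t₁) ∨
          (proj p v P ≤ t₁ ∧ ∀ z ∈ c.support, t₁ ≤ proj p v z))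
    (R : ℝ)
    (hR : IsGreatest ((fun z : Pt m => ‖z - p - proj p v z • v‖) ''
        ((↑c.support : Set (Pt m)) ∪ {P, Q})) R) :
    massOf c ^ α * (|proj p v P - t₁| - Cconst m α * R - |proj p v Q - t₁|) ≤
      dCost X α c (Finsupp.single P (massOf c)) -
        dCost X α c (Finsupp.single Q (massOf c)) := by
  have hle : ∀ z ∈ (↑c.support : Set (Pt m)) ∪ {P, Q}, ‖z - p - proj p v z • v‖ ≤ R :=
    fun z hz => hR.2 ⟨z, hz, rfl⟩
  have hcR : ∀ z ∈ c.support, ‖z - p - proj p v z • v‖ ≤ R := fun z hz => hle z (Or.inl hz)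
  have hQR := hle Q (Or.inr (Or.inr rfl))
  rcases ht with ⟨htP, htc⟩ | ⟨htP, htc⟩
  · rw [abs_of_nonneg (sub_nonneg.2 htP)]
    exact dCost_sub_dCost_ge hXc hXconv hα0 hα1.le hv hmα hc hc0 hP hQ htP htc hcR hQR
  · have h := dCost_sub_dCost_ge (p := p) (v := -v) (t := -t₁) (R := R) hXc hXconv hα0 hα1.le
      (by rwa [norm_neg]) hmα hc hc0 hP hQ (by rw [proj_neg]; linarith)
      (fun z hz => by rw [proj_neg]; linarith [htc z hz])
      (fun z hz => by simpa [proj_neg] using hcR z hz) (by simpa [proj_neg] using hQR)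
    have h1 : |-proj p v Q - -t₁| = |proj p v Q - t₁| := by
      rw [neg_sub_neg, abs_sub_comm]
    rw [proj_neg, proj_neg, h1] at h
    rw [abs_of_nonpos (sub_nonpos.2 htP), neg_sub']
    exact h

end
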